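/- arXiv:1707.06771 — 2 statements merged into one kernel-verified Lean document; each statement's English description precedes it below -/
import Mathlib

section
/- Σ_{n=1}^∞ (2^{2n+1}/C(2n,n)) · H_{n-1} O_n / n^2 = 45 ζ(4), where H_{n-1} is the harmonic number and O_n = Σ_{k=1}^n 1/(2k-1). -/
/-- Harmonic number `H_n = ∑_{j=1}^n 1/j` (with `H_0 = 0`). -/
noncomputable def harmonicNum (n : ℕ) : ℝ := ∑ j ∈ Finset.Icc 1 n, 1 / (j : ℝ)

/-- Odd harmonic number `O_n = ∑_{k=1}^n 1/(2k-1)`. -/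
noncomputable def oddHarmonic (n : ℕ) : ℝ := ∑ k ∈ Finset.Icc 1 n, 1 / (2 * (k : ℝ) - 1)

open Filter Topology Finset

noncomputable def vv (c : ℝ) (n : ℕ) : ℝ := (n.factorial : ℝ) / ∏ k ∈ range (n + 1), (c + k)
noncomputable def PP (c : ℝ) (n : ℕ) : ℝ := ∑ k ∈ range (n + 1), 1 / (c + k)
noncomputable def ff (c : ℝ) (n : ℕ) : ℝ := harmonicNum n * (vv c n / (n + 1) * PP c n)

lemma vv_pos {c : ℝ} (hc : 0 < c) (n : ℕ) : 0 < vv c n := by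
  unfold vv
  have : 0 < ∏ k ∈ range (n + 1), (c + k) := prod_pos fun k _ => by positivity
  positivity

lemma PP_pos {c : ℝ} (hc : 0 < c) (n : ℕ) : 0 < PP c n := by
  unfold PP
  exact sum_pos (fun k _ => by positivity) (by simp)

lemma hN_nonneg (n : ℕ) : 0 ≤ harmonicNum n := by
  unfold harmonicNum
  exact sum_nonneg fun k _ => by positivity

lemma hN_succ (n : ℕ) : harmonicNum (n + 1) = harmonicNum n + 1 / ((n : ℝ) + 1) := by
  unfold harmonicNum
  rw [sum_Icc_succ_top (by omega)]
  push_cast; rfl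

lemma vv_succ {c : ℝ} (hc : 0 < c) (n : ℕ) :
    vv c (n + 1) = vv c n * ((n + 1) / (c + n + 1)) := by
  unfold vv
  have : 0 < ∏ k ∈ range (n + 1), (c + k) := prod_pos fun k _ => by positivity
  rw [prod_range_succ _ (n + 1), Nat.factorial_succ]
  push_cast
  have h2 : c + n + 1 ≠ 0 := by positivity
  have h3 : c + (n + 1) ≠ 0 := by positivity
  field_simp
  ring

lemma PP_succ (c : ℝ) (n : ℕ) : PP c (n + 1) = PP c n + 1 / (c + n + 1) := by
  unfold PP
  rw [sum_range_succ _ (n + 1)]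
  push_cast
  rw [add_assoc]

lemma vv_shift {c : ℝ} (hc : 0 < c) (n : ℕ) :
    vv (c + 1) n = vv c n * (c / (c + n + 1)) := by
  induction n with
  | zero => simp [vv]; field_simp
  | succ n ih =>
    rw [vv_succ (by positivity), vv_succ hc, ih]
    push_cast
    field_simp
    ring

lemma PP_shift {c : ℝ} (hc : 0 < c) (n : ℕ) :
    PP (c + 1) n = PP c n - 1 / c + 1 / (c + n + 1) := by
  induction n with
  | zero => simp [PP]
  | succ n ih =>
    rw [PP_succ, PP_succ, ih]
    push_cast
    ring

noncomputable def TT (c : ℝ) (n : ℕ) : ℝ :=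
  harmonicNum n * (vv c n * PP c n / c + vv c n / c ^ 2)
    + (vv c n * PP c n / c ^ 2 + 2 * vv c n / c ^ 3)

lemma ff_diff {c : ℝ} (hc : 0 < c) (n : ℕ) :
    ff c n - ff (c + 1) n = TT c n - TT c (n + 1) := by
  unfold ff TT
  rw [vv_shift hc, PP_shift hc, vv_succ hc, PP_succ, hN_succ]
  field_simp
  ring

lemma TT_zero {c : ℝ} (hc : 0 < c) : TT c 0 = 3 / c ^ 4 := by
  simp [TT, vv, PP, harmonicNum]
  field_simp
  norm_num

lemma PP_anti {c : ℝ} (hc : 0 < c) (n : ℕ) : PP (c + 1) n ≤ PP c n := by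
  rw [PP_shift hc]
  have : 1 / (c + n + 1) ≤ 1 / c := one_div_le_one_div_of_le hc (by linarith [n.cast_nonneg (α := ℝ)])
  linarith

lemma vv_anti {c : ℝ} (hc : 0 < c) (n : ℕ) : vv (c + 1) n ≤ vv c n := by
  rw [vv_shift hc]
  have : c / (c + n + 1) ≤ 1 := by
    rw [div_le_one (by positivity)]; linarith [n.cast_nonneg (α := ℝ)]
  exact mul_le_of_le_one_right (vv_pos hc n).le this

lemma ff_anti {c : ℝ} (hc : 0 < c) (n : ℕ) : ff (c + 1) n ≤ ff c n := by
  unfold ff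
  have h1 := PP_anti hc n
  have h2 := vv_anti hc n
  have h3 := hN_nonneg n
  have h4 := (PP_pos (c := c + 1) (by positivity) n).le
  have h5 := (vv_pos hc n).le
  gcongr

lemma vv_bound {c : ℝ} (hc : 1 / 2 ≤ c) (n : ℕ) : vv c n ^ 2 * (n + 1) ≤ 4 := by
  have hc0 : 0 < c := by linarith
  induction n with
  | zero =>
    simp [vv]
    rw [show (4 : ℝ) = (2 ^ 2) by norm_num, ← inv_pow]
    have : c⁻¹ ≤ 2 := by rw [inv_le_comm₀ hc0 (by norm_num)]; linarith
    gcongr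
  | succ n ih =>
    rw [vv_succ hc0]
    refine le_trans ?_ ih
    push_cast
    have h : ((n + 1) / (c + n + 1)) ^ 2 * ((n : ℝ) + 1 + 1) ≤ n + 1 := by
      rw [div_pow, div_mul_eq_mul_div, div_le_iff₀ (by positivity)]
      have hn := n.cast_nonneg (α := ℝ)
      have : ((n : ℝ) + 1) * (n + 2) ≤ (c + n + 1) ^ 2 := by nlinarith
      nlinarith
    rw [mul_pow, mul_assoc]
    gcongr

lemma hN_le (n : ℕ) : harmonicNum n ≤ 1 + Real.log (n + 1) := by
  have h := harmonic_le_one_add_log n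
  have e : harmonicNum n = ((harmonic n : ℚ) : ℝ) := by
    induction n with
    | zero => simp [harmonicNum]
    | succ n ih =>
      rw [hN_succ, harmonic_succ, ih (harmonic_le_one_add_log n)]; push_cast; simp
  rw [e]
  refine h.trans ?_
  rcases Nat.eq_zero_or_pos n with rfl | hn
  · simp
  · have : (0 : ℝ) < n := by exact_mod_cast hn
    gcongr; linarith

lemma PP_le {c : ℝ} (hc : 1 / 2 ≤ c) (n : ℕ) : PP c n ≤ 2 + harmonicNum n := by
  have hc0 : 0 < c := by linarith
  induction n with
  | zero =>
    simp [PP, harmonicNum]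
    rw [inv_le_comm₀ hc0 (by norm_num)]; linarith
  | succ n ih =>
    rw [PP_succ, hN_succ]
    have : 1 / (c + n + 1) ≤ 1 / ((n : ℝ) + 1) := by
      gcongr; linarith
    linarith

lemma TT_tendsto {c : ℝ} (hc : 1 / 2 ≤ c) : Tendsto (TT c) atTop (𝓝 0) := by
  have hc0 : 0 < c := by linarith
  have hlim : Tendsto (fun n : ℕ => (3 + Real.log ((n : ℝ) + 1)) ^ 2 / Real.sqrt (n + 1))
      atTop (𝓝 0) := by
    have hx : Tendsto (fun x : ℝ => (3 + Real.log x) ^ 2 / Real.sqrt x) atTop (𝓝 0) := by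
      have h1 : Tendsto (fun x : ℝ => (3 + Real.log x) / x ^ (1 / 4 : ℝ)) atTop (𝓝 0) := by
        have ha : Tendsto (fun x : ℝ => 3 / x ^ (1 / 4 : ℝ)) atTop (𝓝 0) :=
          (tendsto_rpow_atTop (by norm_num)).const_div_atTop 3
        have hb := (isLittleO_log_rpow_atTop (r := 1 / 4) (by norm_num)).tendsto_div_nhds_zero
        simpa [add_div] using ha.add hb
      have h2 := h1.pow 2
      simp only [ne_eq, OfNat.ofNat_ne_zero, not_false_eq_true, zero_pow] at h2
      refine h2.congr' ?_
      filter_upwards [eventually_gt_atTop 0] with x hx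
      rw [div_pow, ← Real.rpow_natCast (x ^ (1 / 4 : ℝ)), ← Real.rpow_mul hx.le, Real.sqrt_eq_rpow]
      norm_num
    exact hx.comp (tendsto_natCast_atTop_atTop.atTop_add tendsto_const_nhds)
  have hlim2 := hlim.const_mul (2 * (1 / c + 1 / c ^ 2 + 1 / c ^ 2 + 2 / c ^ 3))
  rw [mul_zero] at hlim2
  refine squeeze_zero (fun n => ?_) (fun n => ?_) hlim2
  · have h3 := hN_nonneg n
    have h4 := PP_pos hc0 n
    have h5 := vv_pos hc0 n
    unfold TT; positivity
  · have h3 := hN_nonneg n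
    have h4 := PP_pos hc0 n
    have h5 := vv_pos hc0 n
    have hl : 0 ≤ Real.log ((n : ℝ) + 1) :=
      Real.log_nonneg (by linarith [n.cast_nonneg (α := ℝ)])
    set L := 3 + Real.log ((n : ℝ) + 1) with hL
    have hL1 : 1 ≤ L := by linarith
    have hH : harmonicNum n ≤ L := by linarith [hN_le n]
    have hP : PP c n ≤ L := by linarith [hN_le n, PP_le hc n]
    have hv : vv c n ≤ 2 / Real.sqrt (n + 1) := by
      rw [le_div_iff₀ (by positivity)]
      refine abs_le_of_sq_le_sq' ?_ (by norm_num) |>.2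
      rw [mul_pow, Real.sq_sqrt (by positivity)]
      linarith [vv_bound hc n]
    have hLL : L ≤ L ^ 2 := by nlinarith
    have hHP : harmonicNum n * PP c n ≤ L ^ 2 := by
      rw [sq]; gcongr
    have : TT c n = vv c n * (1 / c * (harmonicNum n * PP c n) + 1 / c ^ 2 * harmonicNum n
        + 1 / c ^ 2 * PP c n + 2 / c ^ 3 * 1) := by
      unfold TT; ring
    rw [this]
    calc _ ≤ 2 / Real.sqrt (n + 1) * (1 / c * L ^ 2 + 1 / c ^ 2 * L ^ 2
        + 1 / c ^ 2 * L ^ 2 + 2 / c ^ 3 * L ^ 2) := by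
          gcongr
          · linarith
          · linarith
          · linarith
      _ = _ := by ring

lemma hasSum_inner {c : ℝ} (hc : 1 / 2 ≤ c) :
    HasSum (fun n => ff c n - ff (c + 1) n) (3 / c ^ 4) := by
  have hc0 : 0 < c := by linarith
  rw [hasSum_iff_tendsto_nat_of_nonneg (fun n => sub_nonneg.2 (ff_anti hc0 n))]
  simp_rw [ff_diff hc0, sum_range_sub', TT_zero hc0]
  simpa using (TT_tendsto hc).const_sub (3 / c ^ 4)

lemma ff_tendsto (n : ℕ) : Tendsto (fun m : ℕ => ff (1 / 2 + m) n) atTop (𝓝 0) := by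
  have hP : Tendsto (fun m : ℕ => PP (1 / 2 + m) n) atTop (𝓝 0) := by
    unfold PP
    rw [show (0 : ℝ) = ∑ k ∈ range (n + 1), 0 by simp]
    refine tendsto_finsetSum _ fun k _ => ?_
    refine Tendsto.const_div_atTop ?_ 1
    exact (tendsto_const_nhds.add_atTop tendsto_natCast_atTop_atTop).atTop_add tendsto_const_nhds
  have h := hP.const_mul (harmonicNum n * (vv (1 / 2) n / (n + 1)))
  rw [mul_zero] at h
  have hv : ∀ m : ℕ, vv (1 / 2 + m) n ≤ vv (1 / 2) n := by
    intro m
    induction m with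
    | zero => simp
    | succ m ih =>
      push_cast
      rw [← add_assoc]
      exact (vv_anti (by positivity) n).trans ih
  refine squeeze_zero (fun m => ?_) (fun m => ?_) h
  · have h3 := hN_nonneg n
    have h4 := PP_pos (c := 1 / 2 + m) (by positivity) n
    have h5 := vv_pos (c := 1 / 2 + m) (by positivity) n
    unfold ff; positivity
  · have h3 := hN_nonneg n
    have h4 := PP_pos (c := 1 / 2 + m) (by positivity) n
    unfold ff
    rw [← mul_assoc]
    gcongr
    exact hv m

lemma hasSum_outer (n : ℕ) :
    HasSum (fun m : ℕ => ff (1 / 2 + m) n - ff (1 / 2 + m + 1) n) (ff (1 / 2) n) := by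
  rw [hasSum_iff_tendsto_nat_of_nonneg (fun m => sub_nonneg.2 (ff_anti (by positivity) n))]
  have : ∀ N, ∑ m ∈ range N, (ff (1 / 2 + m) n - ff (1 / 2 + m + 1) n)
      = ff (1 / 2) n - ff (1 / 2 + N) n := by
    intro N
    have := sum_range_sub' (fun m : ℕ => ff (1 / 2 + m) n) N
    simp only [Nat.cast_add, Nat.cast_one, ← add_assoc, Nat.cast_zero, add_zero] at this
    exact this
  simp_rw [this]
  simpa using (ff_tendsto n).const_sub (ff (1 / 2) n)

lemma hasSum_zeta_part : HasSum (fun m : ℕ => 3 / (1 / 2 + (m : ℝ)) ^ 4) (Real.pi ^ 4 / 2) := by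
  have h := hasSum_zeta_four
  have he : HasSum (fun m : ℕ => 1 / ((2 * m : ℕ) : ℝ) ^ 4) (1 / 16 * (Real.pi ^ 4 / 90)) := by
    refine (h.mul_left (1 / 16)).congr_fun ?_ 
    intro m; push_cast; rw [mul_pow]; norm_num; ring
  have hs : Summable (fun m : ℕ => 1 / ((2 * m + 1 : ℕ) : ℝ) ^ 4) :=
    h.summable.comp_injective (i := fun m : ℕ => 2 * m + 1) (fun a b hab => by simpa using hab)
  have ho := hs.hasSum
  have := (HasSum.even_add_odd (f := fun n : ℕ => 1 / (n : ℝ) ^ 4) he ho).unique h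
  have e : ∑' m : ℕ, 1 / ((2 * m + 1 : ℕ) : ℝ) ^ 4 = 15 / 16 * (Real.pi ^ 4 / 90) := by linarith
  rw [e] at ho
  have h2 := ho.mul_left 48
  rw [show 48 * (15 / 16 * (Real.pi ^ 4 / 90)) = Real.pi ^ 4 / 2 by ring] at h2
  refine h2.congr_fun ?_
  intro m
  push_cast
  field_simp
  ring

lemma swap_aux (g : ℕ × ℕ → ℝ) (h0 : ∀ p, 0 ≤ g p) (a b : ℕ → ℝ) (S : ℝ)
    (hi : ∀ m : ℕ, HasSum (fun n => g (m, n)) (a m)) (ha : HasSum a S)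
    (ho : ∀ n : ℕ, HasSum (fun m => g (m, n)) (b n)) : HasSum b S := by
  have hs : Summable g := by
    rw [summable_prod_of_nonneg h0]
    refine ⟨fun m => (hi m).summable, ?_⟩
    have : (fun m => ∑' n, g (m, n)) = a := funext fun m => (hi m).tsum_eq
    rw [this]
    exact ha.summable
  have h1 := hs.hasSum.prod_fiberwise hi
  have e := h1.unique ha
  have h2 := hs.hasSum
  rw [e] at h2
  have h3 : HasSum (g ∘ (Equiv.prodComm ℕ ℕ)) S :=
    (Equiv.hasSum_iff (Equiv.prodComm ℕ ℕ)).2 h2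
  exact HasSum.prod_fiberwise h3 ho

lemma hasSum_ff : HasSum (fun n => ff (1 / 2) n) (Real.pi ^ 4 / 2) := by
  refine swap_aux (fun p => ff (1 / 2 + (p.1 : ℝ)) p.2 - ff (1 / 2 + (p.1 : ℝ) + 1) p.2) ?_
    (fun m : ℕ => 3 / (1 / 2 + (m : ℝ)) ^ 4) _ _ ?_ hasSum_zeta_part ?_
  · intro p
    have h : (0 : ℝ) < 1 / 2 + (p.1 : ℝ) := by positivity
    have h' := ff_anti h p.2
    simp only [sub_nonneg]
    exact h'
  · intro m
    have h : (1 / 2 : ℝ) ≤ 1 / 2 + (m : ℝ) := by linarith [m.cast_nonneg (α := ℝ)]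
    have h' := hasSum_inner h
    dsimp only
    exact h'
  · intro n
    have h' := hasSum_outer n
    dsimp only
    exact h'

lemma vv_half (n : ℕ) :
    (2 : ℝ) ^ (2 * (n + 1)) / (Nat.choose (2 * (n + 1)) (n + 1)) = vv (1 / 2) n * (n + 1) := by
  change _ / ((Nat.centralBinom (n + 1) : ℕ) : ℝ) = _
  induction n with
  | zero => simp [vv, Nat.centralBinom]; norm_num [Nat.choose]
  | succ n ih =>
    have h := Nat.succ_mul_centralBinom_succ (n + 1)
    have h' : ((n : ℝ) + 1 + 1) * (Nat.centralBinom (n + 1 + 1) : ℝ)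
        = 2 * (2 * (n + 1) + 1) * (Nat.centralBinom (n + 1) : ℝ) := by exact_mod_cast h
    have hp : (0 : ℝ) < Nat.centralBinom (n + 1) := by exact_mod_cast Nat.centralBinom_pos _
    have hp' : (0 : ℝ) < Nat.centralBinom (n + 1 + 1) := by exact_mod_cast Nat.centralBinom_pos _
    rw [div_eq_iff hp.ne'] at ih
    rw [div_eq_iff hp'.ne', vv_succ (by norm_num),
      show 2 * (n + 1 + 1) = 2 * (n + 1) + 2 by ring, pow_add, ih]
    push_cast
    have e : (Nat.centralBinom (n + 1 + 1) : ℝ)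
        = 2 * (2 * (n + 1) + 1) * (Nat.centralBinom (n + 1) : ℝ) / (n + 1 + 1) := by
      rw [eq_div_iff (by positivity)]; linarith
    rw [e]
    field_simp
    ring

lemma odd_eq (n : ℕ) : oddHarmonic (n + 1) = PP (1 / 2) n / 2 := by
  induction n with
  | zero => simp [oddHarmonic, PP]; norm_num
  | succ n ih =>
    have : oddHarmonic (n + 1 + 1) = oddHarmonic (n + 1) + 1 / (2 * ((n : ℝ) + 1 + 1) - 1) := by
      unfold oddHarmonic
      rw [sum_Icc_succ_top (by omega)]
      push_cast; rfl
    rw [this, ih, PP_succ]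
    have h : (2 * ((n : ℝ) + 1 + 1) - 1) = 2 * (1 / 2 + n + 1) := by ring
    rw [h]
    field_simp

theorem sum_central_binom_eq_45_zeta_four :
    ((∑' n : ℕ, (2 : ℝ) ^ (2 * (n + 1) + 1) / (Nat.choose (2 * (n + 1)) (n + 1)) *
        (harmonicNum n * oddHarmonic (n + 1)) / ((n : ℝ) + 1) ^ 2 : ℝ) : ℂ) =
      45 * riemannZeta 4 := by
  have h : ∀ n : ℕ, (2 : ℝ) ^ (2 * (n + 1) + 1) / (Nat.choose (2 * (n + 1)) (n + 1)) *
        (harmonicNum n * oddHarmonic (n + 1)) / ((n : ℝ) + 1) ^ 2 = ff (1 / 2) n := by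
    intro n
    rw [pow_succ, mul_div_right_comm ((2 : ℝ) ^ (2 * (n + 1))) 2, vv_half, odd_eq, ff]
    field_simp
  simp_rw [h]
  rw [hasSum_ff.tsum_eq, riemannZeta_four]
  push_cast
  ring
end

section
/- Σ_{n=1}^∞ (2^{2n}/C(2n,n)) · H_{n-1}(O_n^2 + O_n^{(2)}) / n^2 = 93 ζ(5), where O_n^{(s)} = Σ_{k=1}^n 1/(2k-1)^s, O_n = O_n^{(1)}, and H_{n-1} is the harmonic number. -/
/-- Odd harmonic number of order `s`: `O_n^{(s)} = ∑_{k=1}^n 1/(2k-1)^s`. -/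
noncomputable def oddHarmonicPow (n s : ℕ) : ℝ :=
  ∑ k ∈ Finset.Icc 1 n, 1 / (2 * (k : ℝ) - 1) ^ s

noncomputable def bb (n : ℕ) (c : ℝ) : ℝ := ∏ i ∈ Finset.range n, (c + i)⁻¹
noncomputable def pp (s n : ℕ) (c : ℝ) : ℝ := ∑ i ∈ Finset.range n, ((c + i)⁻¹) ^ s
noncomputable def b2 (n : ℕ) (c : ℝ) : ℝ := bb n c * ((pp 1 n c ^ 2 + pp 2 n c) / 2)
noncomputable def WW (m : ℕ) (c : ℝ) : ℝ :=
  (m.factorial : ℝ) * bb (m + 1) c *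
   (harmonicNum m * ((pp 1 (m+1) c ^ 2 + pp 2 (m+1) c) / 2) / c
    + harmonicNum m * pp 1 (m+1) c / c ^ 2 + harmonicNum m / c ^ 3
    + ((pp 1 (m+1) c ^ 2 + pp 2 (m+1) c) / 2) / c ^ 2 + 2 * pp 1 (m+1) c / c ^ 3 + 3 / c ^ 4)

theorem harmonicNum_succ (m : ℕ) : harmonicNum (m + 1) = harmonicNum m + 1 / ((m : ℝ) + 1) := by
  unfold harmonicNum
  rw [Finset.sum_Icc_succ_top (by omega)]
  push_cast
  rfl

theorem harmonicNum_nonneg (m : ℕ) : 0 ≤ harmonicNum m :=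
  Finset.sum_nonneg fun _ _ => by positivity

theorem bb_nonneg (n : ℕ) (c : ℝ) (hc : 0 < c) : 0 ≤ bb n c :=
  Finset.prod_nonneg fun _ _ => by positivity

theorem pp_nonneg (s n : ℕ) (c : ℝ) (hc : 0 < c) : 0 ≤ pp s n c :=
  Finset.sum_nonneg fun _ _ => by positivity

theorem b2_nonneg (n : ℕ) (c : ℝ) (hc : 0 < c) : 0 ≤ b2 n c := by
  have := bb_nonneg n c hc
  have := pp_nonneg 2 n c hc
  unfold b2
  positivity

theorem W_step (m : ℕ) (c : ℝ) (hc : 0 < c) :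
    (m.factorial : ℝ) * harmonicNum m * b2 (m + 2) c = WW m c - WW (m + 1) c := by
  have h1 : bb (m + 1 + 1) c = bb (m + 1) c * (c + (m + 1))⁻¹ := by
    unfold bb; rw [Finset.prod_range_succ _ (m + 1)]; push_cast; rfl
  have h2 (s : ℕ) : pp s (m + 1 + 1) c = pp s (m + 1) c + ((c + (m + 1))⁻¹) ^ s := by
    unfold pp; rw [Finset.sum_range_succ _ (m + 1)]; push_cast; rfl
  have h3 : ((m + 1).factorial : ℝ) = (m + 1) * m.factorial := by
    rw [Nat.factorial_succ]; push_cast; rfl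
  unfold WW b2
  rw [show m + 2 = m + 1 + 1 from rfl, h1, h2, h2, h3, harmonicNum_succ]
  generalize pp 1 (m + 1) c = p
  generalize pp 2 (m + 1) c = q
  generalize bb (m + 1) c = b
  generalize harmonicNum m = H
  generalize (m.factorial : ℝ) = e
  have hm : (0 : ℝ) < (m : ℝ) + 1 := by positivity
  generalize (m : ℝ) + 1 = x at *
  have : c + x ≠ 0 := by positivity
  have : x ≠ 0 := by positivity
  field_simp
  ring

theorem b2_diff (n : ℕ) (c : ℝ) (hc : 0 < c) :
    b2 n c - b2 n (c + 1) = n * b2 (n + 1) c := by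
  have h1 : bb (n + 1) c = bb n c * (c + n)⁻¹ := by
    unfold bb; rw [Finset.prod_range_succ]
  have h2 (s : ℕ) : pp s (n + 1) c = pp s n c + ((c + n)⁻¹) ^ s := by
    unfold pp; rw [Finset.sum_range_succ]
  have h1' : bb (n + 1) c = bb n (c + 1) * c⁻¹ := by
    unfold bb; rw [Finset.prod_range_succ']; push_cast; simp only [add_assoc, add_comm (1 : ℝ), add_zero]
  have h2' (s : ℕ) : pp s (n + 1) c = pp s n (c + 1) + (c⁻¹) ^ s := by
    unfold pp; rw [Finset.sum_range_succ']; push_cast; simp only [add_assoc, add_comm (1 : ℝ), add_zero]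
  have e1 : bb n (c + 1) = bb n c * (c + n)⁻¹ * c := by
    rw [← h1, h1']; field_simp
  have e2 (s : ℕ) : pp s n (c + 1) = pp s n c + ((c + n)⁻¹) ^ s - (c⁻¹) ^ s := by
    rw [← h2, h2']; ring
  unfold b2
  rw [e1, e2, e2, h1, h2, h2]
  have : c + n ≠ 0 := by positivity
  field_simp
  ring

theorem eb_bound (m : ℕ) (c : ℝ) (hc : 1 / 2 ≤ c) :
    ((m.factorial : ℝ) * bb (m + 1) c) ^ 2 ≤ 4 / (m + 1) := by
  have hc0 : 0 < c := by linarith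
  induction m with
  | zero =>
    simp [bb]
    rw [inv_le_comm₀ (by positivity) (by norm_num)]
    nlinarith
  | succ m ih =>
    have h1 : bb (m + 1 + 1) c = bb (m + 1) c * (c + (m + 1))⁻¹ := by
      unfold bb; rw [Finset.prod_range_succ _ (m + 1)]; push_cast; rfl
    have h3 : ((m + 1).factorial : ℝ) = (m + 1) * m.factorial := by
      rw [Nat.factorial_succ]; push_cast; rfl
    rw [h1, h3]
    have : ((m : ℝ) + 1) * m.factorial * (bb (m + 1) c * (c + (m + 1))⁻¹)
      = (m.factorial * bb (m + 1) c) * ((m + 1) * (c + (m + 1))⁻¹) := by ring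
    rw [this, mul_pow]
    have h4 : (((m : ℝ) + 1) * (c + (m + 1))⁻¹) ^ 2 ≤ (m + 1) / (m + 2) := by
      rw [← div_eq_mul_inv, div_pow, div_le_div_iff₀ (by positivity) (by positivity)]
      have hm : (0 : ℝ) ≤ m := by positivity
      have : ((m : ℝ) + 1) * (m + 2) ≤ (c + (m + 1)) ^ 2 := by nlinarith
      nlinarith
    calc _ ≤ 4 / ((m : ℝ) + 1) * ((m + 1) / (m + 2)) := by gcongr
      _ = _ := by push_cast; field_simp; ring

theorem pp2_le (n : ℕ) (c : ℝ) (hc : 0 < c) : pp 2 n c ≤ pp 1 n c ^ 2 := by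
  induction n with
  | zero => simp [pp]
  | succ n ih =>
    have h2 (s : ℕ) : pp s (n + 1) c = pp s n c + ((c + n)⁻¹) ^ s := by
      unfold pp; rw [Finset.sum_range_succ]
    rw [h2, h2]
    have := pp_nonneg 1 n c hc
    have : 0 ≤ (c + n)⁻¹ := by positivity
    nlinarith [mul_nonneg (pp_nonneg 1 n c hc) this]

theorem pp1_le (n : ℕ) (c : ℝ) (hc : 1 / 2 ≤ c) : pp 1 n c ≤ 2 * harmonicNum n := by
  induction n with
  | zero => simp [pp, harmonicNum]
  | succ n ih =>
    have h2 (s : ℕ) : pp s (n + 1) c = pp s n c + ((c + n)⁻¹) ^ s := by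
      unfold pp; rw [Finset.sum_range_succ]
    rw [h2, harmonicNum_succ]
    have hn : (0 : ℝ) ≤ n := by positivity
    have : (c + n)⁻¹ ≤ 2 * (1 / ((n : ℝ) + 1)) := by
      rw [← one_div, mul_one_div, div_le_div_iff₀ (by positivity) (by positivity)]
      linarith
    rw [pow_one]; linarith

theorem harmonicNum_le (n : ℕ) : harmonicNum n ≤ 1 + Real.log n := by
  have := harmonic_le_one_add_log n
  rw [harmonic_eq_sum_Icc] at this
  unfold harmonicNum
  push_cast at this
  simpa using this

theorem WW_nonneg (m : ℕ) (c : ℝ) (hc : 0 < c) : 0 ≤ WW m c := by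
  have := bb_nonneg (m+1) c hc
  have := pp_nonneg 2 (m+1) c hc
  have := pp_nonneg 1 (m+1) c hc
  have := harmonicNum_nonneg m
  unfold WW
  positivity

theorem WW_le (m : ℕ) (c : ℝ) (hc : 1 / 2 ≤ c) :
    WW m c ≤ 2 / √((m : ℝ) + 1) * (120 * (2 + Real.log ((m : ℝ) + 1)) ^ 3) := by
  have hc0 : 0 < c := by linarith
  have hb := bb_nonneg (m+1) c hc0
  have hq0 := pp_nonneg 2 (m+1) c hc0
  have hp0 := pp_nonneg 1 (m+1) c hc0
  have hH0 := harmonicNum_nonneg m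
  have hH1 : harmonicNum m ≤ harmonicNum (m + 1) := by
    rw [harmonicNum_succ]
    have : (0 : ℝ) ≤ 1 / (m + 1) := by positivity
    linarith
  have hl := harmonicNum_le (m + 1)
  push_cast at hl
  have hlog : 0 ≤ Real.log ((m : ℝ) + 1) := Real.log_nonneg (by
    have : (0 : ℝ) ≤ m := by positivity
    linarith)
  have hp := pp1_le (m + 1) c hc
  have hq := pp2_le (m + 1) c hc0
  set L := 2 + Real.log ((m : ℝ) + 1) with hL
  have hL1 : 1 ≤ L := by linarith
  have hHL : harmonicNum m ≤ L := by linarith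
  have hpL : pp 1 (m + 1) c ≤ 2 * L := by linarith
  have hh0 : 0 ≤ (pp 1 (m+1) c ^ 2 + pp 2 (m+1) c) / 2 := by positivity
  have hhL : (pp 1 (m+1) c ^ 2 + pp 2 (m+1) c) / 2 ≤ 4 * L ^ 2 := by nlinarith
  have hci : c⁻¹ ≤ 2 := by
    rw [inv_le_comm₀ hc0 (by norm_num)]; linarith
  have he : (m.factorial : ℝ) * bb (m + 1) c ≤ 2 / √((m : ℝ) + 1) := by
    apply le_of_sq_le_sq _ (by positivity)
    rw [div_pow, Real.sq_sqrt (by positivity)]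
    have := eb_bound m c hc
    norm_num at this ⊢
    exact this
  unfold WW
  apply mul_le_mul he _ (by positivity) (by positivity)
  generalize (pp 1 (m+1) c ^ 2 + pp 2 (m+1) c) / 2 = h at *
  generalize pp 1 (m+1) c = p at *
  generalize harmonicNum m = H at *
  simp only [div_eq_mul_inv, ← inv_pow]
  have hci0 : 0 ≤ c⁻¹ := by positivity
  generalize c⁻¹ = d at *
  have hL0 : 0 ≤ L := by linarith
  calc _ ≤ L * (4 * L ^ 2) * 2 + L * (2 * L) * 2 ^ 2 + L * 2 ^ 3 + (4 * L ^ 2) * 2 ^ 2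
        + 2 * (2 * L) * 2 ^ 3 + 3 * 2 ^ 4 := by gcongr
    _ ≤ _ := by
      have h2 : L ≤ L ^ 3 := by nlinarith [mul_nonneg hL0 (mul_nonneg hL0 (sub_nonneg.2 hL1)), mul_nonneg hL0 (sub_nonneg.2 hL1)]
      have h3 : L ^ 2 ≤ L ^ 3 := by nlinarith [mul_nonneg hL0 (mul_nonneg hL0 (sub_nonneg.2 hL1))]
      nlinarith

theorem WW_tendsto (c : ℝ) (hc : 1 / 2 ≤ c) :
    Filter.Tendsto (fun m => WW m c) Filter.atTop (nhds 0) := by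
  have hc0 : 0 < c := by linarith
  have key : Filter.Tendsto (fun x : ℝ => 2 / √x * (120 * (2 + Real.log x) ^ 3))
      Filter.atTop (nhds 0) := by
    have h1 : (fun x : ℝ => 2 + Real.log x) =o[Filter.atTop] fun x : ℝ => x ^ (1/6 : ℝ) := by
      apply Asymptotics.IsLittleO.add
      · rw [Asymptotics.isLittleO_const_left]
        right
        exact tendsto_norm_atTop_atTop.comp (tendsto_rpow_atTop (by norm_num))
      · exact isLittleO_log_rpow_atTop (by norm_num)
    have h2 := (h1.pow (n := 3) (by norm_num)).tendsto_div_nhds_zero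
    have h3 := h2.const_mul 240
    rw [mul_zero] at h3
    refine h3.congr' ?_
    filter_upwards [Filter.eventually_gt_atTop 0] with x hx
    rw [← Real.rpow_natCast (x ^ _), ← Real.rpow_mul hx.le, Real.sqrt_eq_rpow]
    norm_num
    ring
  have k2 : Filter.Tendsto (fun m : ℕ => (m : ℝ) + 1) Filter.atTop Filter.atTop :=
    Filter.tendsto_atTop_add_const_right _ _ tendsto_natCast_atTop_atTop
  exact squeeze_zero (fun m => WW_nonneg m c hc0) (fun m => WW_le m c hc) (key.comp k2)

theorem hasSum_telescope (f : ℕ → ℝ) (hf : Filter.Tendsto f Filter.atTop (nhds 0))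
    (h : ∀ n, 0 ≤ f n - f (n + 1)) : HasSum (fun n => f n - f (n + 1)) (f 0) := by
  rw [hasSum_iff_tendsto_nat_of_nonneg h]
  simp only [Finset.sum_range_sub']
  simpa using hf.const_sub (f 0)

theorem WW_zero (c : ℝ) (hc : 0 < c) : WW 0 c = 6 / c ^ 5 := by
  simp [WW, bb, pp, harmonicNum]
  field_simp
  ring

/-- the double family -/
noncomputable def FF (k m : ℕ) : ℝ :=
  (m.factorial : ℝ) * harmonicNum m * b2 (m + 2) (1 / 2 + k)

theorem FF_nonneg (k m : ℕ) : 0 ≤ FF k m := by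
  have := b2_nonneg (m + 2) (1 / 2 + k) (by positivity)
  have := harmonicNum_nonneg m
  unfold FF
  positivity

theorem FF_sum_m (k : ℕ) : HasSum (fun m => FF k m) (6 / (1 / 2 + (k : ℝ)) ^ 5) := by
  have hc : (1 : ℝ) / 2 ≤ 1 / 2 + k := by
    have : (0 : ℝ) ≤ k := by positivity
    linarith
  have hc0 : (0 : ℝ) < 1 / 2 + k := by positivity
  have e (m : ℕ) : FF k m = WW m (1 / 2 + k) - WW (m + 1) (1 / 2 + k) := W_step m _ hc0
  rw [← WW_zero _ hc0, funext e]
  exact hasSum_telescope _ (WW_tendsto _ hc) fun n => by rw [← e]; exact FF_nonneg _ _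

theorem FF_sum_k (m : ℕ) : HasSum (fun k => FF k m)
    ((m.factorial : ℝ) * harmonicNum m / (m + 1) * b2 (m + 1) (1 / 2)) := by
  have e (k : ℕ) : FF k m =
      (fun k : ℕ => (m.factorial : ℝ) * harmonicNum m / (m + 1) * b2 (m + 1) (1 / 2 + k)) k -
      (fun k : ℕ => (m.factorial : ℝ) * harmonicNum m / (m + 1) * b2 (m + 1) (1 / 2 + k)) (k + 1) := by
    have := b2_diff (m + 1) (1 / 2 + k) (by positivity)
    simp only
    push_cast at this ⊢
    rw [← mul_sub, ← add_assoc, this]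
    unfold FF
    field_simp
  have hi (i : ℕ) : Filter.Tendsto (fun k : ℕ => ((1 / 2 + (k : ℝ)) + i)⁻¹) Filter.atTop (nhds 0) := by
    apply Filter.Tendsto.inv_tendsto_atTop
    apply Filter.tendsto_atTop_add_const_right
    apply Filter.tendsto_atTop_add_const_left
    exact tendsto_natCast_atTop_atTop
  have hb : Filter.Tendsto (fun k : ℕ => bb (m + 1) (1 / 2 + k)) Filter.atTop (nhds (∏ i ∈ Finset.range (m+1), 0)) := by
    unfold bb
    exact tendsto_finsetProd _ fun i _ => hi i
  have hp (s : ℕ) (hs : s ≠ 0) : Filter.Tendsto (fun k : ℕ => pp s (m + 1) (1 / 2 + k)) Filter.atTop (nhds 0) := by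
    unfold pp
    have := tendsto_finsetSum (Finset.range (m+1)) fun i (_ : i ∈ Finset.range (m+1)) => (hi i).pow s
    simpa [hs] using this
  have hlim : Filter.Tendsto (fun k : ℕ => (m.factorial : ℝ) * harmonicNum m / (m + 1) * b2 (m + 1) (1 / 2 + k)) Filter.atTop (nhds 0) := by
    have := (hb.mul ((((hp 1 (by norm_num)).pow 2).add (hp 2 (by norm_num))).div_const 2)).const_mul ((m.factorial : ℝ) * harmonicNum m / (m + 1))
    simpa [b2] using this
  have := hasSum_telescope _ hlim fun k => by
    have := FF_nonneg k m
    rw [e] at this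
    exact this
  simp only [Nat.cast_zero, add_zero] at this
  rw [funext e]
  exact this

theorem odd_sum : HasSum (fun k : ℕ => 6 / (1 / 2 + (k : ℝ)) ^ 5) (186 * ∑' n : ℕ, 1 / (n : ℝ) ^ 5) := by
  have hs : Summable (fun n : ℕ => 1 / (n : ℝ) ^ 5) := Real.summable_one_div_nat_pow.2 (by norm_num)
  have he : Summable (fun k : ℕ => 1 / ((2 * k : ℕ) : ℝ) ^ 5) :=
    hs.comp_injective (i := fun k : ℕ => 2 * k) fun a b h => by simpa using h
  have ho : Summable (fun k : ℕ => 1 / ((2 * k + 1 : ℕ) : ℝ) ^ 5) :=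
    hs.comp_injective (i := fun k : ℕ => 2 * k + 1) fun a b h => by simpa using h
  have h := tsum_even_add_odd (f := fun n : ℕ => 1 / (n : ℝ) ^ 5) he ho
  have h2 : ∑' k : ℕ, 1 / ((2 * k : ℕ) : ℝ) ^ 5 = 1 / 32 * ∑' n : ℕ, 1 / (n : ℝ) ^ 5 := by
    rw [← tsum_mul_left]
    congr 1; ext k; push_cast; rw [mul_pow]; norm_num; ring
  have h3 := ho.hasSum.mul_left 192
  have h4 : 192 * ∑' k : ℕ, 1 / ((2 * k + 1 : ℕ) : ℝ) ^ 5 = 186 * ∑' n : ℕ, 1 / (n : ℝ) ^ 5 := by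
    linarith
  rw [h4] at h3
  have h5 : (fun k : ℕ => 6 / (1 / 2 + (k : ℝ)) ^ 5) =
      fun k : ℕ => 192 * (1 / ((2 * k + 1 : ℕ) : ℝ) ^ 5) := by
    funext k
    push_cast
    rw [show (1 / 2 + (k : ℝ)) = (2 * k + 1) / 2 by ring]
    have : (2 * (k : ℝ) + 1) ≠ 0 := by positivity
    field_simp
    norm_num
  rw [h5]
  exact h3

theorem bb_half (m : ℕ) : (m.factorial : ℝ) * bb (m + 1) (1 / 2) =
    2 ^ (2 * (m + 1)) / (Nat.choose (2 * (m + 1)) (m + 1)) / ((m : ℝ) + 1) := by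
  change _ = 2 ^ (2 * (m + 1)) / (Nat.centralBinom (m + 1) : ℝ) / ((m : ℝ) + 1)
  induction m with
  | zero => simp [bb, Nat.centralBinom]; norm_num
  | succ m ih =>
    have h1 : bb (m + 1 + 1) (1/2) = bb (m + 1) (1/2) * (1/2 + ((m : ℝ) + 1))⁻¹ := by
      unfold bb; rw [Finset.prod_range_succ _ (m + 1)]; push_cast; rfl
    have h3 : ((m + 1).factorial : ℝ) = (m + 1) * m.factorial := by
      rw [Nat.factorial_succ]; push_cast; rfl
    have h4 := Nat.succ_mul_centralBinom_succ (m + 1)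
    have h5 : ((m : ℝ) + 1 + 1) * Nat.centralBinom (m + 1 + 1) = 2 * (2 * (m + 1) + 1) * Nat.centralBinom (m + 1) := by
      exact_mod_cast h4
    have h6 : (Nat.centralBinom (m + 1) : ℝ) ≠ 0 := by exact_mod_cast Nat.centralBinom_ne_zero _
    have h7 : (Nat.centralBinom (m + 1 + 1) : ℝ) = 2 * (2 * (m + 1) + 1) * Nat.centralBinom (m + 1) / ((m : ℝ) + 1 + 1) := by
      rw [← h5]; field_simp
    have : ((m : ℝ) + 1) * m.factorial * (bb (m + 1) (1/2) * (1/2 + ((m : ℝ) + 1))⁻¹)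
      = (m.factorial * bb (m + 1) (1/2)) * ((m + 1) * (1/2 + ((m : ℝ) + 1))⁻¹) := by ring
    rw [h1, h3, this, ih, h7]
    push_cast
    field_simp
    ring

theorem pp_half (s n : ℕ) : pp s n (1 / 2) = 2 ^ s * oddHarmonicPow n s := by
  induction n with
  | zero => simp [pp, oddHarmonicPow]
  | succ n ih =>
    have h2 : pp s (n + 1) (1/2) = pp s n (1/2) + ((1/2 + (n:ℝ))⁻¹) ^ s := by
      unfold pp; rw [Finset.sum_range_succ]
    have h3 : oddHarmonicPow (n + 1) s = oddHarmonicPow n s + 1 / (2 * ((n : ℝ) + 1) - 1) ^ s := by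
      unfold oddHarmonicPow
      rw [Finset.sum_Icc_succ_top (by omega)]
      push_cast; rfl
    rw [h2, h3, ih, mul_add, mul_one_div, ← div_pow]
    congr 2
    have : 2 * ((n : ℝ) + 1) - 1 ≠ 0 := by
      have : (0 : ℝ) ≤ n := by positivity
      linarith
    rw [inv_eq_one_div, div_eq_div_iff (by positivity) this]
    ring

theorem sum_central_binom_eq_93_zeta_five :
    ((∑' n : ℕ, (2 : ℝ) ^ (2 * (n + 1)) / (Nat.choose (2 * (n + 1)) (n + 1)) *
        (harmonicNum n * (oddHarmonicPow (n + 1) 1 ^ 2 + oddHarmonicPow (n + 1) 2)) /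
          ((n : ℝ) + 1) ^ 2 : ℝ) : ℂ) = 93 * riemannZeta 5 := by
  have hz : riemannZeta 5 = ((∑' n : ℕ, 1 / (n : ℝ) ^ 5 : ℝ) : ℂ) := by
    have := zeta_nat_eq_tsum_of_gt_one (k := 5) (by norm_num)
    push_cast at this ⊢
    exact this
  rw [hz]
  have hS : Summable (Function.uncurry FF) := by
    rw [summable_prod_of_nonneg (f := Function.uncurry FF) (fun x => FF_nonneg x.1 x.2)]
    refine ⟨fun k => (FF_sum_m k).summable, ?_⟩
    have : (fun k => ∑' m, Function.uncurry FF (k, m)) = fun k : ℕ => 6 / (1 / 2 + (k : ℝ)) ^ 5 :=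
      funext fun k => (FF_sum_m k).tsum_eq
    rw [this]
    exact odd_sum.summable
  have hc := hS.tsum_comm
  rw [show (∑' k, ∑' m, FF k m) = 186 * ∑' n : ℕ, 1 / (n : ℝ) ^ 5 by
    rw [← odd_sum.tsum_eq]; exact tsum_congr fun k => (FF_sum_m k).tsum_eq] at hc
  have h : ∀ n : ℕ, (2 : ℝ) ^ (2 * (n + 1)) / (Nat.choose (2 * (n + 1)) (n + 1)) *
        (harmonicNum n * (oddHarmonicPow (n + 1) 1 ^ 2 + oddHarmonicPow (n + 1) 2)) /
          ((n : ℝ) + 1) ^ 2 = 1 / 2 * ∑' k, FF k n := by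
    intro n
    rw [(FF_sum_k n).tsum_eq]
    unfold b2
    rw [pp_half, pp_half]
    have := bb_half n
    calc _ = (2 : ℝ) ^ (2 * (n + 1)) / (Nat.choose (2 * (n + 1)) (n + 1)) / ((n : ℝ) + 1) *
        (harmonicNum n * (oddHarmonicPow (n + 1) 1 ^ 2 + oddHarmonicPow (n + 1) 2)) / ((n : ℝ) + 1) := by
          field_simp
      _ = _ := by rw [← this]; ring
  rw [tsum_congr h, tsum_mul_left]
  have : 1 / 2 * ∑' n, ∑' k, FF k n = 93 * ∑' n : ℕ, 1 / (n : ℝ) ^ 5 := by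
    linarith
  rw [this]
  push_cast
  rfl
end
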